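/- Let A and B be n×n positive definite complex matrices, t ∈ [0,1] and r ≥ 0. Then ‖A + B + r(A♯_t B + A♯_{1−t} B)‖₂ ≤ ‖A + B + r(A^t B^{1−t} + A^{1−t} B^t)‖₂, where ‖X‖₂ = (Tr(X*X))^{1/2} is the Hilbert–Schmidt (Frobenius) norm and X* denotes the conjugate transpose. -/

import Mathlib

open Matrix ComplexOrder

/-- Real power of a Hermitian matrix via the functional calculus (spectral decomposition). -/
noncomputable def mpow {n : ℕ} (A : Matrix (Fin n) (Fin n) ℂ) (r : ℝ) :
    Matrix (Fin n) (Fin n) ℂ :=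
  if hA : A.IsHermitian then
    (hA.eigenvectorUnitary : Matrix (Fin n) (Fin n) ℂ) *
      Matrix.diagonal (fun i => ((hA.eigenvalues i ^ r : ℝ) : ℂ)) *
      (star hA.eigenvectorUnitary : Matrix (Fin n) (Fin n) ℂ)
  else 0

/-- The t-geometric mean `A ♯ₜ B = A^{1/2} (A^{-1/2} B A^{-1/2})^t A^{1/2}`. -/
noncomputable def geomMean {n : ℕ} (A B : Matrix (Fin n) (Fin n) ℂ) (t : ℝ) :
    Matrix (Fin n) (Fin n) ℂ :=
  mpow A (1/2) * mpow (mpow A (-(1/2)) * B * mpow A (-(1/2))) t * mpow A (1/2)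

/-- Eigenvalues of a Hermitian matrix in decreasing order. -/
noncomputable def eigsDesc {n : ℕ} (M : Matrix (Fin n) (Fin n) ℂ) : Fin n → ℝ :=
  if hM : M.IsHermitian then fun i => hM.eigenvalues (Tuple.sort hM.eigenvalues (Fin.rev i))
  else 0

/-- The trace norm ‖X‖₁ = Tr((X*X)^{1/2}). -/
noncomputable def traceNorm {n : ℕ} (X : Matrix (Fin n) (Fin n) ℂ) : ℝ :=
  ((mpow (Xᴴ * X) (1/2)).trace).re

/-- The Hilbert–Schmidt (Frobenius) norm ‖X‖₂ = (Tr(X*X))^{1/2}. -/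
noncomputable def hsNorm {n : ℕ} (X : Matrix (Fin n) (Fin n) ℂ) : ℝ :=
  Real.sqrt ((Xᴴ * X).trace.re)


section Mpow

variable {n : ℕ} {A : Matrix (Fin n) (Fin n) ℂ}

lemma mpow_eq_cfc (hA : A.IsHermitian) (r : ℝ) : mpow A r = cfc (fun x : ℝ => x ^ r) A := by
  rw [hA.cfc_eq, mpow, dif_pos hA, IsHermitian.cfc, Unitary.conjStarAlgAut_apply]
  rfl

open scoped MatrixOrder Matrix.Norms.L2Operator in
lemma mpow_eq_rpow (hA : A.PosDef) (r : ℝ) : mpow A r = A ^ r := by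
  rw [mpow_eq_cfc hA.isHermitian, CFC.rpow_eq_cfc_real hA.posSemidef.nonneg]

open scoped MatrixOrder Matrix.Norms.L2Operator in
lemma mpow_posDef (hA : A.PosDef) (r : ℝ) : (mpow A r).PosDef := by
  rw [mpow_eq_rpow hA]
  exact (IsStrictlyPositive.rpow A r hA.isStrictlyPositive).posDef

open scoped MatrixOrder Matrix.Norms.L2Operator in
lemma mpow_mul_mpow (hA : A.PosDef) (r s : ℝ) : mpow A r * mpow A s = mpow A (r + s) := by
  simp only [mpow_eq_rpow hA]
  rw [CFC.rpow_add hA.isUnit]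

open scoped MatrixOrder Matrix.Norms.L2Operator in
lemma mpow_zero' (hA : A.PosDef) : mpow A 0 = 1 := by
  rw [mpow_eq_rpow hA, CFC.rpow_zero A hA.posSemidef.nonneg]

open scoped MatrixOrder Matrix.Norms.L2Operator in
lemma mpow_one' (hA : A.PosDef) : mpow A 1 = A := by
  rw [mpow_eq_rpow hA, CFC.rpow_one A hA.posSemidef.nonneg]

open scoped MatrixOrder Matrix.Norms.L2Operator in
lemma mpow_mpow (hA : A.PosDef) (r s : ℝ) : mpow (mpow A r) s = mpow A (r * s) := by
  rw [mpow_eq_rpow (mpow_posDef hA r)]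
  simp only [mpow_eq_rpow hA]
  rcases eq_or_ne r 0 with rfl | hr
  · rw [zero_mul, CFC.rpow_zero A hA.posSemidef.nonneg, CFC.one_rpow]
  · exact CFC.rpow_rpow A r s hr hA.isStrictlyPositive

lemma mpow_neg_mul_mpow (hA : A.PosDef) (r : ℝ) : mpow A (-r) * mpow A r = 1 := by
  rw [mpow_mul_mpow hA, neg_add_cancel, mpow_zero' hA]

lemma mpow_mul_mpow_neg (hA : A.PosDef) (r : ℝ) : mpow A r * mpow A (-r) = 1 := by
  rw [mpow_mul_mpow hA, add_neg_cancel, mpow_zero' hA]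

open scoped Matrix.Norms.L2Operator in
lemma mpow_conj (hA : A.IsHermitian) (U : unitary (Matrix (Fin n) (Fin n) ℂ)) (r : ℝ) :
    mpow ((U : Matrix (Fin n) (Fin n) ℂ) * A * star (U : Matrix (Fin n) (Fin n) ℂ)) r =
      (U : Matrix (Fin n) (Fin n) ℂ) * mpow A r * star (U : Matrix (Fin n) (Fin n) ℂ) := by
  have hB : ((U : Matrix (Fin n) (Fin n) ℂ) * A *
      star (U : Matrix (Fin n) (Fin n) ℂ)).IsHermitian :=
    isHermitian_mul_mul_conjTranspose _ hA
  have hc : Continuous (Unitary.conjStarAlgAut ℂ (Matrix (Fin n) (Fin n) ℂ) U) := by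
    have : Continuous fun X : Matrix (Fin n) (Fin n) ℂ =>
        (U : Matrix (Fin n) (Fin n) ℂ) * X * star (U : Matrix (Fin n) (Fin n) ℂ) := by fun_prop
    exact this
  have h := StarAlgHomClass.map_cfc (S := ℂ) (Unitary.conjStarAlgAut ℂ (Matrix (Fin n) (Fin n) ℂ) U)
    (fun x : ℝ => x ^ r) A (Matrix.finite_real_spectrum.continuousOn _) hc hA
    (by rw [Unitary.conjStarAlgAut_apply]; exact hB)
  rw [mpow_eq_cfc hA, mpow_eq_cfc hB]
  simpa only [Unitary.conjStarAlgAut_apply] using h.symm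

open scoped Matrix.Norms.L2Operator MatrixOrder in
lemma continuous_mpow_comp {X : Type*} [TopologicalSpace X] {M : X → Matrix (Fin n) (Fin n) ℂ}
    (hM : Continuous M) (hpos : ∀ x, (M x).PosDef) (r : ℝ) :
    Continuous fun x => mpow (M x) r := by
  have h := (CFC.continuousOn_rpow (A := Matrix (Fin n) (Fin n) ℂ) r).comp_continuous hM
    fun x => (hpos x).isStrictlyPositive
  exact h.congr fun x => (mpow_eq_rpow (hpos x) r).symm

end Mpow

section Resolvent

open MeasureTheory Real

variable {n : ℕ} {M N : Matrix (Fin n) (Fin n) ℂ}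

/-- The resolvent `(M + x)⁻¹`. -/
noncomputable def resolventAt (M : Matrix (Fin n) (Fin n) ℂ) (x : ℝ) : Matrix (Fin n) (Fin n) ℂ :=
  (M + (x : ℂ) • 1)⁻¹

lemma posDef_add_smul_one (hM : M.PosDef) {x : ℝ} (hx : 0 ≤ x) :
    (M + (x : ℂ) • (1 : Matrix (Fin n) (Fin n) ℂ)).PosDef :=
  hM.add_posSemidef (PosSemidef.one.smul (by exact_mod_cast hx))

lemma resolventAt_isHermitian (hM : M.PosDef) {x : ℝ} (hx : 0 ≤ x) :
    (resolventAt M x).IsHermitian :=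
  (posDef_add_smul_one hM hx).inv.isHermitian

lemma mul_resolventAt (hM : M.PosDef) {x : ℝ} (hx : 0 ≤ x) :
    M * resolventAt M x = 1 - (x : ℂ) • resolventAt M x := by
  have h := mul_nonsing_inv _
    ((isUnit_iff_isUnit_det _).mp (posDef_add_smul_one hM hx).isUnit)
  rw [eq_sub_iff_add_eq, ← h, resolventAt, add_mul, smul_mul_assoc, one_mul]

lemma resolventAt_mul (hM : M.PosDef) {x : ℝ} (hx : 0 ≤ x) :
    resolventAt M x * M = 1 - (x : ℂ) • resolventAt M x := by
  have h := nonsing_inv_mul _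
    ((isUnit_iff_isUnit_det _).mp (posDef_add_smul_one hM hx).isUnit)
  rw [eq_sub_iff_add_eq, ← h, resolventAt, mul_add, mul_smul_comm, mul_one]

lemma mpow_apply (hM : M.IsHermitian) (r : ℝ) (i j : Fin n) :
    mpow M r i j = ∑ p, (hM.eigenvectorUnitary : Matrix (Fin n) (Fin n) ℂ) i p *
      ((hM.eigenvalues p ^ r : ℝ) : ℂ) *
      star ((hM.eigenvectorUnitary : Matrix (Fin n) (Fin n) ℂ) j p) := by
  rw [mpow, dif_pos hM, mul_apply]
  simp [mul_diagonal, star_apply]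

lemma resolventAt_apply (hM : M.PosDef) {x : ℝ} (hx : 0 ≤ x) (i j : Fin n) :
    resolventAt M x i j =
      ∑ p, (hM.isHermitian.eigenvectorUnitary : Matrix (Fin n) (Fin n) ℂ) i p *
      (((x + hM.isHermitian.eigenvalues p)⁻¹ : ℝ) : ℂ) *
      star ((hM.isHermitian.eigenvectorUnitary : Matrix (Fin n) (Fin n) ℂ) j p) := by
  set V := (hM.isHermitian.eigenvectorUnitary : Matrix (Fin n) (Fin n) ℂ) with hV
  set m := hM.isHermitian.eigenvalues with hm
  have h1 : V * star V = 1 := Unitary.coe_mul_star_self _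
  have h2 : star V * V = 1 := Unitary.coe_star_mul_self _
  have hpos : ∀ p, (x + m p) ≠ 0 := fun p => (add_pos_of_nonneg_of_pos hx (hM.eigenvalues_pos p)).ne'
  have hMs : M = V * diagonal (fun p => ((m p : ℝ) : ℂ)) * star V := by
    have := hM.isHermitian.spectral_theorem
    rw [Unitary.conjStarAlgAut_apply] at this
    exact this
  have hs : M + (x : ℂ) • 1 = V * diagonal (fun p => ((x + m p : ℝ) : ℂ)) * star V := by
    have : diagonal (fun p => ((x + m p : ℝ) : ℂ)) =
        diagonal (fun p => ((m p : ℝ) : ℂ)) + (x : ℂ) • (1 : Matrix (Fin n) (Fin n) ℂ) := by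
      rw [smul_one_eq_diagonal, diagonal_add]
      congr 1; funext p; push_cast; ring
    rw [this, mul_add, add_mul, ← hMs, mul_smul_comm, smul_mul_assoc, mul_one, h1]
  have hinv : resolventAt M x = V * diagonal (fun p => (((x + m p)⁻¹ : ℝ) : ℂ)) * star V := by
    refine inv_eq_right_inv ?_
    rw [hs]
    calc _ = V * diagonal (fun p => ((x + m p : ℝ) : ℂ)) * (star V * V) *
          diagonal (fun p => (((x + m p)⁻¹ : ℝ) : ℂ)) * star V := by simp only [mul_assoc]
      _ = 1 := by
        rw [h2, mul_one, mul_assoc V, diagonal_mul_diagonal]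
        have : (fun p => ((x + m p : ℝ) : ℂ) * (((x + m p)⁻¹ : ℝ) : ℂ)) = fun _ => 1 := by
          funext p
          rw [← Complex.ofReal_mul, mul_inv_cancel₀ (hpos p), Complex.ofReal_one]
        rw [this, diagonal_one, mul_one, h1]
  rw [hinv, mul_apply]
  simp [mul_diagonal, star_apply]

lemma sum_normSq_eigenvectorUnitary (hM : M.IsHermitian) (i : Fin n) :
    ∑ p, Complex.normSq ((hM.eigenvectorUnitary : Matrix (Fin n) (Fin n) ℂ) i p) = 1 := by
  have h : (hM.eigenvectorUnitary : Matrix (Fin n) (Fin n) ℂ) *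
    star (hM.eigenvectorUnitary : Matrix (Fin n) (Fin n) ℂ) = 1 := Unitary.coe_mul_star_self _
  have h' := congr_fun (congr_fun h i) i
  rw [mul_apply, one_apply_eq] at h'
  simp only [star_apply, RCLike.star_def, Complex.mul_conj] at h'
  exact_mod_cast h'

lemma re_sum_mul_ofReal_mul_star (v : Fin n → ℂ) (c : Fin n → ℝ) :
    (∑ p, v p * (c p : ℂ) * star (v p)).re = ∑ p, Complex.normSq (v p) * c p := by
  rw [Complex.re_sum]
  refine Finset.sum_congr rfl fun p _ => ?_
  rw [mul_right_comm, RCLike.star_def, Complex.mul_conj, ← Complex.ofReal_mul, Complex.ofReal_re]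

/-- The normalising constant in the integral representation of `x ↦ x ^ t`. -/
noncomputable def rpowConst (t : ℝ) : ℝ := (∫ x in Set.Ioi 0, rpowIntegrand₀₁ t x 1)⁻¹

lemma rpowConst_pos {t : ℝ} (ht : t ∈ Set.Ioo (0 : ℝ) 1) : 0 < rpowConst t :=
  inv_pos.mpr (integral_rpowIntegrand₀₁_one_pos ht)

lemma inv_sub_resolventAt_re (hM : M.PosDef) {x : ℝ} (hx : 0 ≤ x) (t : ℝ) (i : Fin n) :
    x ^ t * (x⁻¹ - (resolventAt M x i i).re) =
      ∑ p, Complex.normSq ((hM.isHermitian.eigenvectorUnitary : Matrix (Fin n) (Fin n) ℂ) i p) *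
        rpowIntegrand₀₁ t x (hM.isHermitian.eigenvalues p) := by
  rw [resolventAt_apply hM hx, re_sum_mul_ofReal_mul_star]
  conv_lhs => rw [← one_mul x⁻¹, ← sum_normSq_eigenvectorUnitary hM.isHermitian i]
  rw [Finset.sum_mul, ← Finset.sum_sub_distrib, Finset.mul_sum]
  refine Finset.sum_congr rfl fun p _ => ?_
  rw [rpowIntegrand₀₁]
  ring

lemma integrableOn_inv_sub_resolventAt (hM : M.PosDef) {t : ℝ} (ht : t ∈ Set.Ioo (0 : ℝ) 1)
    (i : Fin n) :
    IntegrableOn (fun x => x ^ t * (x⁻¹ - (resolventAt M x i i).re)) (Set.Ioi 0) := by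
  refine IntegrableOn.congr_fun ?_
    (fun x hx => (inv_sub_resolventAt_re hM (le_of_lt hx) t i).symm) measurableSet_Ioi
  exact integrable_finsetSum _ fun p _ =>
    (integrableOn_rpowIntegrand₀₁_Ioi ht (hM.eigenvalues_pos p).le).const_mul _

lemma mpow_apply_re_eq_integral (hM : M.PosDef) {t : ℝ} (ht : t ∈ Set.Ioo (0 : ℝ) 1)
    (i : Fin n) :
    (mpow M t i i).re =
      rpowConst t * ∫ x in Set.Ioi 0, x ^ t * (x⁻¹ - (resolventAt M x i i).re) := by
  rw [setIntegral_congr_fun measurableSet_Ioi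
    (fun x hx => inv_sub_resolventAt_re hM (le_of_lt hx) t i), integral_finsetSum]
  · rw [mpow_apply hM.isHermitian, re_sum_mul_ofReal_mul_star, Finset.mul_sum]
    refine Finset.sum_congr rfl fun p _ => ?_
    rw [integral_const_mul, rpow_eq_const_mul_integral ht (hM.eigenvalues_pos p).le, rpowConst]
    ring
  · exact fun p _ => (integrableOn_rpowIntegrand₀₁_Ioi ht (hM.eigenvalues_pos p).le).const_mul _

lemma integrableOn_rpow_mul_inv_mul_inv {t : ℝ} (ht : t ∈ Set.Ioo (0 : ℝ) 1) {a b : ℝ}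
    (ha : 0 < a) (hb : 0 < b) :
    IntegrableOn (fun x => x ^ t * ((x + a)⁻¹ * (x + b)⁻¹)) (Set.Ioi 0) := by
  refine Integrable.mono' ((integrableOn_rpowIntegrand₀₁_Ioi ht hb.le).const_mul b⁻¹) ?_ ?_
  · refine ContinuousOn.aestronglyMeasurable ?_ measurableSet_Ioi
    intro x hx
    have hx : 0 < x := hx
    refine ContinuousAt.continuousWithinAt ?_
    have h1 : x + a ≠ 0 := by positivity
    have h2 : x + b ≠ 0 := by positivity
    have h3 : ContinuousAt (fun x : ℝ => x ^ t) x := continuousAt_rpow_const _ _ (Or.inl hx.ne')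
    fun_prop (disch := assumption)
  · refine (ae_restrict_iff' measurableSet_Ioi).mpr (.of_forall fun x hx => ?_)
    have hx : 0 < x := hx
    have hxt : 0 < x ^ t := rpow_pos_of_pos hx t
    rw [norm_of_nonneg (by positivity), rpowIntegrand₀₁]
    have : b⁻¹ * (x ^ t * (x⁻¹ - (x + b)⁻¹)) = x ^ t * (x⁻¹ * (x + b)⁻¹) := by
      field_simp
      ring
    rw [this]
    gcongr
    linarith

lemma integrableOn_resolventAt_mul (hM : M.PosDef) {t : ℝ} (ht : t ∈ Set.Ioo (0 : ℝ) 1)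
    (i j k l : Fin n) (c : ℂ) :
    IntegrableOn (fun x => x ^ t * (resolventAt M x i j * c * resolventAt M x k l).re)
      (Set.Ioi 0) := by
  set V := (hM.isHermitian.eigenvectorUnitary : Matrix (Fin n) (Fin n) ℂ) with hV
  set m := hM.isHermitian.eigenvalues with hm
  have key : ∀ x ∈ Set.Ioi (0 : ℝ),
      ∑ p, ∑ q, (V i p * star (V j p) * c * (V k q * star (V l q))).re *
        (x ^ t * ((x + m p)⁻¹ * (x + m q)⁻¹)) =
      x ^ t * (resolventAt M x i j * c * resolventAt M x k l).re := by
    intro x hx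
    rw [resolventAt_apply hM (le_of_lt hx), resolventAt_apply hM (le_of_lt hx), Finset.sum_mul,
      Finset.sum_mul_sum, Complex.re_sum, Finset.mul_sum]
    refine Finset.sum_congr rfl fun p _ => ?_
    rw [Complex.re_sum, Finset.mul_sum]
    refine Finset.sum_congr rfl fun q _ => ?_
    rw [show V i p * (((x + m p)⁻¹ : ℝ) : ℂ) * star (V j p) * c *
        (V k q * (((x + m q)⁻¹ : ℝ) : ℂ) * star (V l q)) =
        (V i p * star (V j p) * c * (V k q * star (V l q))) *
        (((x + m p)⁻¹ * (x + m q)⁻¹ : ℝ) : ℂ) by push_cast; ring, Complex.re_mul_ofReal]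
    ring
  refine IntegrableOn.congr_fun ?_ key measurableSet_Ioi
  exact integrable_finsetSum _ fun p _ => integrable_finsetSum _ fun q _ =>
    (integrableOn_rpow_mul_inv_mul_inv ht (hM.eigenvalues_pos p) (hM.eigenvalues_pos q)).const_mul _

lemma neg_resolventAt_re_le (hM : M.PosDef) (hN : N.PosDef) {x : ℝ} (hx : 0 ≤ x) (i : Fin n) :
    -(resolventAt N x i i).re ≤ -(resolventAt M x i i).re +
      ((resolventAt M x * (N - M) * resolventAt M x) i i).re := by
  set R := resolventAt M x with hR
  set S := resolventAt N x with hS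
  have hRh : Rᴴ = R := resolventAt_isHermitian hM hx
  have hSh : Sᴴ = S := resolventAt_isHermitian hN hx
  have h1 := (posDef_add_smul_one hN hx).posSemidef.conjTranspose_mul_mul_same (S - R)
  have h2 := h1.diag_nonneg (i := i)
  have e1 : N * S = 1 - (x : ℂ) • S := mul_resolventAt hN hx
  have e2 : S * N = 1 - (x : ℂ) • S := resolventAt_mul hN hx
  have e3 : M * R = 1 - (x : ℂ) • R := mul_resolventAt hM hx
  have e4 : R * (M * R) = R - (x : ℂ) • (R * R) := by rw [e3, mul_sub, mul_one, mul_smul_comm]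
  have e : (S - R)ᴴ * (N + (x : ℂ) • 1) * (S - R) = S - R + R * (N - M) * R := by
    rw [conjTranspose_sub, hRh, hSh, mul_assoc]
    have : (N + (x : ℂ) • 1) * (S - R) = 1 - N * R - (x : ℂ) • R := by
      rw [mul_sub, add_mul, add_mul, e1, smul_mul_assoc, smul_mul_assoc, one_mul, one_mul]
      abel
    rw [this]
    have e5 : S * (N * R) = R - (x : ℂ) • (S * R) := by
      rw [← mul_assoc, e2, sub_mul, one_mul, smul_mul_assoc]
    have e6 : R * (N - M) * R = R * (N * R) - (R - (x : ℂ) • (R * R)) := by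
      rw [← e4]; noncomm_ring
    rw [e6]
    simp only [sub_mul, mul_sub, mul_one, mul_smul_comm, e5, smul_sub]
    abel
  rw [e] at h2
  have h3 := (Complex.le_def.mp h2).1
  simp only [Matrix.add_apply, Matrix.sub_apply, Complex.add_re, Complex.sub_re, Complex.zero_re] at h3
  linarith

end Resolvent

section TraceWeights

open MeasureTheory Real

variable {n : ℕ} {M N : Matrix (Fin n) (Fin n) ℂ}

/-- The coefficients of the differential of `M ↦ (mpow M t) i i` in the direction of the
entries of `M`. -/
noncomputable def mpowWeight (M : Matrix (Fin n) (Fin n) ℂ) (t : ℝ) (i j k : Fin n) : ℝ :=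
  rpowConst t *
    ∫ x in Set.Ioi 0, x ^ t * (resolventAt M x i j * M j k * resolventAt M x k i).re

lemma mpow_apply_re_le (hM : M.PosDef) (hN : N.PosDef) {t : ℝ} (ht : t ∈ Set.Ioo (0 : ℝ) 1)
    {κ : Fin n → Fin n → ℝ} (hκ : ∀ j k, N j k - M j k = (κ j k : ℂ) * M j k) (i : Fin n) :
    (mpow N t i i).re ≤ (mpow M t i i).re + ∑ j, ∑ k, κ j k * mpowWeight M t i j k := by
  have hTint := integrableOn_resolventAt_mul hM ht
  have hsum : ∑ j, ∑ k, κ j k * mpowWeight M t i j k = rpowConst t * ∫ x in Set.Ioi 0,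
      ∑ j, ∑ k, κ j k * (x ^ t * (resolventAt M x i j * M j k * resolventAt M x k i).re) := by
    rw [integral_finsetSum _ fun j _ => integrable_finsetSum _ fun k _ =>
      (hTint i j k i (M j k)).const_mul _, Finset.mul_sum]
    refine Finset.sum_congr rfl fun j _ => ?_
    rw [integral_finsetSum _ fun k _ => (hTint i j k i (M j k)).const_mul _, Finset.mul_sum]
    refine Finset.sum_congr rfl fun k _ => ?_
    rw [integral_const_mul, mpowWeight]
    ring
  have hI : IntegrableOn (fun x => ∑ j, ∑ k, κ j k *
      (x ^ t * (resolventAt M x i j * M j k * resolventAt M x k i).re)) (Set.Ioi 0) :=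
    integrable_finsetSum _ fun j _ => integrable_finsetSum _ fun k _ =>
      (hTint i j k i (M j k)).const_mul _
  rw [hsum, mpow_apply_re_eq_integral hM ht, mpow_apply_re_eq_integral hN ht, ← mul_add,
    ← integral_add (integrableOn_inv_sub_resolventAt hM ht i) hI]
  refine mul_le_mul_of_nonneg_left ?_ (rpowConst_pos ht).le
  refine setIntegral_mono_on (integrableOn_inv_sub_resolventAt hN ht i)
    ((integrableOn_inv_sub_resolventAt hM ht i).add hI) measurableSet_Ioi fun x hx => ?_
  have hx : 0 < x := hx
  have h := neg_resolventAt_re_le hM hN hx.le i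
  have e : ((resolventAt M x * (N - M) * resolventAt M x) i i).re =
      ∑ j, ∑ k, κ j k * (resolventAt M x i j * M j k * resolventAt M x k i).re := by
    rw [mul_apply]
    simp only [mul_apply, Finset.sum_mul, Complex.re_sum]
    rw [Finset.sum_comm]
    refine Finset.sum_congr rfl fun j _ => Finset.sum_congr rfl fun k _ => ?_
    rw [Matrix.sub_apply, hκ, ← Complex.re_ofReal_mul]
    congr 1
    ring
  rw [e] at h
  have h2 := mul_le_mul_of_nonneg_left h (rpow_pos_of_pos hx t).le
  have e2 : ∑ j, ∑ k, κ j k *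
      (x ^ t * (resolventAt M x i j * M j k * resolventAt M x k i).re) =
      x ^ t * ∑ j, ∑ k, κ j k * (resolventAt M x i j * M j k * resolventAt M x k i).re := by
    simp only [Finset.mul_sum]
    refine Finset.sum_congr rfl fun j _ => Finset.sum_congr rfl fun k _ => ?_
    ring
  rw [e2]
  linarith

open scoped Matrix.Norms.L2Operator in
lemma mpow_smul (hM : M.PosDef) {c : ℝ} (hc : 0 < c) (t : ℝ) :
    mpow ((c : ℂ) • M) t = ((c ^ t : ℝ) : ℂ) • mpow M t := by
  have hcM : ((c : ℂ) • M).IsHermitian := (hM.smul (by exact_mod_cast hc)).isHermitian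
  have hcont := fun f : ℝ → ℝ => (Matrix.finite_real_spectrum (A := M)).continuousOn f
  rw [mpow_eq_cfc hcM, mpow_eq_cfc hM.isHermitian, Complex.coe_smul, Complex.coe_smul,
    ← cfc_smul (c ^ t) _ M (hcont _)]
  refine (cfc_comp_smul c (fun x : ℝ => x ^ t) M
      ((Matrix.finite_real_spectrum (A := M)).image _ |>.continuousOn _)
      hM.isHermitian).symm.trans (cfc_congr fun x hx => ?_)
  rw [hM.isHermitian.spectrum_real_eq_range_eigenvalues] at hx
  obtain ⟨p, rfl⟩ := hx
  simp only [smul_eq_mul]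
  exact mul_rpow hc.le (hM.eigenvalues_pos p).le

lemma sum_mpowWeight (hM : M.PosDef) {t : ℝ} (ht : t ∈ Set.Ioo (0 : ℝ) 1) (i : Fin n) :
    ∑ j, ∑ k, mpowWeight M t i j k = t * (mpow M t i i).re := by
  set S := ∑ j, ∑ k, mpowWeight M t i j k with hS
  set m := (mpow M t i i).re with hm
  have hle : ∀ h : ℝ, exp (h * t) * m ≤ m + (exp h - 1) * S := by
    intro h
    have := mpow_apply_re_le (N := ((exp h : ℝ) : ℂ) • M) hM
      (hM.smul (by exact_mod_cast exp_pos h)) ht (κ := fun _ _ => exp h - 1)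
      (fun j k => by rw [Matrix.smul_apply, smul_eq_mul]; push_cast; ring) i
    rw [mpow_smul hM (exp_pos h), ← exp_mul, Matrix.smul_apply, smul_eq_mul,
      Complex.re_ofReal_mul] at this
    simpa only [← Finset.mul_sum] using this
  have hd : HasDerivAt (fun h : ℝ => m + (exp h - 1) * S - exp (h * t) * m) (S - t * m) 0 := by
    have h1 := ((((hasDerivAt_exp 0).sub_const 1).mul_const S).const_add m).sub
      ((((hasDerivAt_id (0 : ℝ)).mul_const t).exp).mul_const m)
    refine h1.congr_deriv ?_
    simp
  have hmin : IsLocalMin (fun h : ℝ => m + (exp h - 1) * S - exp (h * t) * m) 0 := by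
    refine .of_forall fun h => ?_
    have := hle h
    simp only [exp_zero, zero_mul]
    linarith
  have := hmin.hasDerivAt_eq_zero hd
  linarith

lemma sum_mul_mpowWeight_nonpos (hM : M.PosDef) {t : ℝ} (ht : t ∈ Set.Ioo (0 : ℝ) 1)
    {g l : Fin n → ℝ} (hgl : ∀ i j, 0 ≤ (g i - g j) * (l i - l j)) :
    ∑ i, g i * ∑ j, ∑ k, (l i - (l j + l k) / 2) * mpowWeight M t i j k ≤ 0 := by
  have hTint := integrableOn_resolventAt_mul hM ht
  have hsum : ∑ i, g i * ∑ j, ∑ k, (l i - (l j + l k) / 2) * mpowWeight M t i j k =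
      rpowConst t * ∫ x in Set.Ioi 0, ∑ i, ∑ j, ∑ k, (g i * (l i - (l j + l k) / 2)) *
        (x ^ t * (resolventAt M x i j * M j k * resolventAt M x k i).re) := by
    rw [integral_finsetSum _ fun i _ => integrable_finsetSum _ fun j _ =>
      integrable_finsetSum _ fun k _ => (hTint i j k i (M j k)).const_mul _, Finset.mul_sum]
    refine Finset.sum_congr rfl fun i _ => ?_
    rw [integral_finsetSum _ fun j _ => integrable_finsetSum _ fun k _ =>
      (hTint i j k i (M j k)).const_mul _, Finset.mul_sum, Finset.mul_sum]
    refine Finset.sum_congr rfl fun j _ => ?_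
    rw [integral_finsetSum _ fun k _ => (hTint i j k i (M j k)).const_mul _, Finset.mul_sum,
      Finset.mul_sum]
    refine Finset.sum_congr rfl fun k _ => ?_
    rw [integral_const_mul, mpowWeight]
    ring
  rw [hsum]
  refine mul_nonpos_of_nonneg_of_nonpos (rpowConst_pos ht).le ?_
  refine setIntegral_nonpos measurableSet_Ioi fun x hx => ?_
  have hx : 0 < x := hx
  set R := resolventAt M x with hR
  have hRh : R.IsHermitian := resolventAt_isHermitian hM hx.le
  have hsq : ∀ i j, (R i j * R j i).re = Complex.normSq (R i j) := by
    intro i j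
    rw [← hRh.apply j i, RCLike.star_def, Complex.mul_conj, Complex.ofReal_re]
  have hRM : ∀ i k, ∑ j, R i j * M j k = (1 : Matrix (Fin n) (Fin n) ℂ) i k - x * R i k := by
    intro i k
    rw [← mul_apply, resolventAt_mul hM hx.le]; rfl
  have hMR : ∀ j i, ∑ k, M j k * R k i = (1 : Matrix (Fin n) (Fin n) ℂ) j i - x * R j i := by
    intro i k
    rw [← mul_apply, mul_resolventAt hM hx.le]; rfl
  have hdiag : ∀ i j, (l i - l j) * (R i j * ((1 : Matrix (Fin n) (Fin n) ℂ) j i - x * R j i)).re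
      = -x * ((l i - l j) * Complex.normSq (R i j)) := by
    intro i j
    rcases eq_or_ne j i with rfl | h
    · simp
    · rw [one_apply_ne h, zero_sub, mul_neg, Complex.neg_re, ← hsq,
        show R i j * (x * R j i) = x * (R i j * R j i) by ring, Complex.re_ofReal_mul]
      ring
  have hA : ∀ i, ∑ j, ∑ k, (l i - l j) * (R i j * M j k * R k i).re =
      ∑ j, -x * ((l i - l j) * Complex.normSq (R i j)) := by
    intro i
    refine Finset.sum_congr rfl fun j _ => ?_
    rw [← hdiag, ← hMR, Finset.mul_sum, Complex.re_sum, Finset.mul_sum]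
    simp only [mul_assoc]
  have hB : ∀ i, ∑ j, ∑ k, (l i - l k) * (R i j * M j k * R k i).re =
      ∑ j, -x * ((l i - l j) * Complex.normSq (R i j)) := by
    intro i
    rw [Finset.sum_comm]
    refine Finset.sum_congr rfl fun k _ => ?_
    have e : R i k * ((1 : Matrix (Fin n) (Fin n) ℂ) k i - x * R k i) =
        ((1 : Matrix (Fin n) (Fin n) ℂ) i k - x * R i k) * R k i := by
      rcases eq_or_ne k i with rfl | h
      · ring
      · rw [one_apply_ne h, one_apply_ne h.symm]; ring
    rw [← hdiag, ← Finset.mul_sum, ← Complex.re_sum, ← Finset.sum_mul, hRM, e]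
  have hfin : ∑ i, ∑ j, ∑ k, (g i * (l i - (l j + l k) / 2)) *
      (x ^ t * (R i j * M j k * R k i).re) =
      -(x ^ t * x) * ∑ i, ∑ j, g i * ((l i - l j) * Complex.normSq (R i j)) := by
    rw [Finset.mul_sum]
    refine Finset.sum_congr rfl fun i _ => ?_
    have : ∑ j, ∑ k, (g i * (l i - (l j + l k) / 2)) * (x ^ t * (R i j * M j k * R k i).re) =
      (x ^ t * g i / 2) * (∑ j, ∑ k, (l i - l j) * (R i j * M j k * R k i).re +
        ∑ j, ∑ k, (l i - l k) * (R i j * M j k * R k i).re) := by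
      rw [← Finset.sum_add_distrib, Finset.mul_sum]
      refine Finset.sum_congr rfl fun j _ => ?_
      rw [← Finset.sum_add_distrib, Finset.mul_sum]
      refine Finset.sum_congr rfl fun k _ => ?_
      ring
    rw [this, hA, hB, ← two_mul, Finset.mul_sum, Finset.mul_sum, Finset.mul_sum]
    refine Finset.sum_congr rfl fun j _ => ?_
    ring
  have hsymm : 2 * ∑ i, ∑ j, g i * ((l i - l j) * Complex.normSq (R i j)) =
      ∑ i, ∑ j, (g i - g j) * (l i - l j) * Complex.normSq (R i j) := by
    have hswap : ∑ i, ∑ j, g i * ((l i - l j) * Complex.normSq (R i j)) =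
        ∑ i, ∑ j, g j * ((l j - l i) * Complex.normSq (R i j)) := by
      rw [Finset.sum_comm]
      refine Finset.sum_congr rfl fun i _ => Finset.sum_congr rfl fun j _ => ?_
      rw [← hsq, ← hsq, mul_comm (R j i)]
    rw [two_mul]
    nth_rewrite 2 [hswap]
    rw [← Finset.sum_add_distrib]
    refine Finset.sum_congr rfl fun i _ => ?_
    rw [← Finset.sum_add_distrib]
    refine Finset.sum_congr rfl fun j _ => ?_
    ring
  have hnn : 0 ≤ ∑ i, ∑ j, (g i - g j) * (l i - l j) * Complex.normSq (R i j) :=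
    Finset.sum_nonneg fun i _ => Finset.sum_nonneg fun j _ =>
      mul_nonneg (hgl i j) (Complex.normSq_nonneg _)
  rw [hfin]
  have : 0 ≤ x ^ t * x := by positivity
  nlinarith

end TraceWeights

section DiagonalScaling

open Real Filter Topology

variable {n : ℕ} {C : Matrix (Fin n) (Fin n) ℂ}

/-- The real power `a ^ s` of `a = diag(exp l)`. -/
noncomputable def expDiag (l : Fin n → ℝ) (s : ℝ) : Matrix (Fin n) (Fin n) ℂ :=
  diagonal fun i => ((exp (s * l i) : ℝ) : ℂ)

lemma expDiag_isHermitian (l : Fin n → ℝ) (s : ℝ) : (expDiag l s).IsHermitian := by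
  rw [expDiag, isHermitian_diagonal_iff]
  intro i
  exact Complex.conj_ofReal _

lemma expDiag_mul (l : Fin n → ℝ) (s u : ℝ) :
    expDiag l s * expDiag l u = expDiag l (s + u) := by
  rw [expDiag, expDiag, diagonal_mul_diagonal, expDiag]
  congr 1
  funext i
  rw [← Complex.ofReal_mul, ← exp_add, add_mul]

lemma expDiag_zero (l : Fin n → ℝ) : expDiag l 0 = 1 := by
  simp [expDiag]

/-- The congruence `a ^ (s / 2) C a ^ (s / 2)` with `a = diag(exp l)`. -/
noncomputable def expConj (l : Fin n → ℝ) (C : Matrix (Fin n) (Fin n) ℂ) (s : ℝ) :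
    Matrix (Fin n) (Fin n) ℂ :=
  expDiag l (s / 2) * C * expDiag l (s / 2)

lemma expConj_apply (l : Fin n → ℝ) (C : Matrix (Fin n) (Fin n) ℂ) (s : ℝ) (i j : Fin n) :
    expConj l C s i j = ((exp (s * (l i + l j) / 2) : ℝ) : ℂ) * C i j := by
  rw [expConj, expDiag, mul_diagonal, diagonal_mul, mul_right_comm, ← Complex.ofReal_mul,
    ← exp_add]
  congr 3
  ring

lemma expConj_posDef (l : Fin n → ℝ) (hC : C.PosDef) (s : ℝ) : (expConj l C s).PosDef := by
  have h := hC.mul_mul_conjTranspose_same (B := expDiag l (s / 2)) (by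
    refine Function.LeftInverse.injective (g := fun v => v ᵥ* expDiag l (-(s / 2))) fun v => ?_
    simp only [vecMul_vecMul, expDiag_mul, add_neg_cancel, expDiag_zero, vecMul_one])
  rwa [expDiag_isHermitian] at h

lemma continuous_expConj (l : Fin n → ℝ) (C : Matrix (Fin n) (Fin n) ℂ) :
    Continuous (expConj l C) := by
  refine continuous_matrix fun i j => ?_
  simp only [expConj_apply]
  fun_prop

lemma sum_exp_mul_mpow_expConj_le (l : Fin n → ℝ) (hC : C.PosDef) {t : ℝ}
    (ht : t ∈ Set.Ioo (0 : ℝ) 1) :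
    ∑ i, exp (2 * l i) * (mpow C t i i).re ≤
      ∑ i, exp ((2 - t) * l i) * (mpow (expConj l C 1) t i i).re := by
  set f : ℝ → ℝ := fun x => ∑ i, exp ((2 - (1 - x) * t) * l i) *
    (mpow (expConj l C (1 - x)) t i i).re with hf
  have hcont : Continuous f := by
    have h := continuous_mpow_comp (M := fun x : ℝ => expConj l C (1 - x))
      ((continuous_expConj l C).comp (continuous_const.sub continuous_id))
      (fun x => expConj_posDef l hC _) t
    refine continuous_finsetSum _ fun i _ => ?_
    refine Continuous.mul (by fun_prop) ?_
    exact Complex.continuous_re.comp (h.matrix_elem i i)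
  have hmain : f 1 ≤ f 0 := by
    refine image_le_of_liminf_slope_right_le_deriv_boundary (a := 0) (b := 1)
      (B := fun _ => f 0) (B' := fun _ => 0) hcont.continuousOn le_rfl continuousOn_const
      (fun x _ => hasDerivWithinAt_const _ _ _) ?_ ⟨zero_le_one, le_rfl⟩
    intro x hx r hr
    set M := expConj l C (1 - x) with hMdef
    have hM : M.PosDef := expConj_posDef l hC _
    set g : Fin n → ℝ := fun i => exp ((2 - (1 - x) * t) * l i) with hg
    set m : Fin n → ℝ := fun i => (mpow M t i i).re with hm
    set E : ℝ → ℝ := fun z => ∑ i, exp ((2 - (1 - z) * t) * l i) * (m i + ∑ j, ∑ k,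
      (exp (-(z - x) * (l j + l k) / 2) - 1) * mpowWeight M t i j k) with hE
    have hfE : ∀ z, f z ≤ E z := by
      intro z
      refine Finset.sum_le_sum fun i _ => mul_le_mul_of_nonneg_left ?_ (exp_pos _).le
      refine mpow_apply_re_le hM (expConj_posDef l hC _) ht (fun j k => ?_) i
      rw [hMdef, expConj_apply, expConj_apply,
        show (1 - z) * (l j + l k) / 2 =
          -(z - x) * (l j + l k) / 2 + (1 - x) * (l j + l k) / 2 by ring, exp_add]
      push_cast
      ring
    have hEx : E x = f x := by
      simp [hE, hf, hm, hMdef]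
    have hdE : HasDerivAt E (∑ i, g i * ∑ j, ∑ k,
        (l i - (l j + l k) / 2) * mpowWeight M t i j k) x := by
      have h1 : HasDerivAt E (∑ i, (g i * (t * l i) * (m i + ∑ j, ∑ k,
          (exp (-(x - x) * (l j + l k) / 2) - 1) * mpowWeight M t i j k) +
          g i * (∑ j, ∑ k, (exp (-(x - x) * (l j + l k) / 2) * (-1 * (l j + l k) / 2)) *
            mpowWeight M t i j k))) x := by
        refine HasDerivAt.fun_sum fun i _ => HasDerivAt.mul ?_ ?_
        · refine HasDerivAt.exp ?_
          have := ((((hasDerivAt_id x).const_sub 1).mul_const t).const_sub 2).mul_const (l i)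
          exact this.congr_deriv (by ring)
        · refine HasDerivAt.const_add _ (HasDerivAt.fun_sum fun j _ => HasDerivAt.fun_sum
            fun k _ => HasDerivAt.mul_const (HasDerivAt.sub_const _ (HasDerivAt.exp ?_)) _)
          exact ((((hasDerivAt_id x).sub_const x).neg).mul_const (l j + l k)).div_const 2
      refine h1.congr_deriv (Finset.sum_congr rfl fun i _ => ?_)
      simp only [sub_self, neg_zero, zero_mul, zero_div, exp_zero, Finset.sum_const_zero,
        add_zero, one_mul]
      have hF := sum_mpowWeight hM ht i
      rw [show g i * (t * l i) * m i = g i * (l i * (t * m i)) by ring, hm, ← hF, ← mul_add,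
        Finset.mul_sum, ← Finset.sum_add_distrib]
      congr 1
      refine Finset.sum_congr rfl fun j _ => ?_
      rw [Finset.mul_sum, ← Finset.sum_add_distrib]
      refine Finset.sum_congr rfl fun k _ => ?_
      ring
    have hnonpos : ∑ i, g i * ∑ j, ∑ k,
        (l i - (l j + l k) / 2) * mpowWeight M t i j k ≤ 0 := by
      refine sum_mul_mpowWeight_nonpos hM ht fun i j => ?_
      have hpos : 0 < 2 - (1 - x) * t := by nlinarith [hx.1, hx.2, ht.1, ht.2]
      rcases le_total (l i) (l j) with h | h
      · exact mul_nonneg_of_nonpos_of_nonpos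
          (sub_nonpos.mpr (exp_le_exp.mpr (mul_le_mul_of_nonneg_left h hpos.le)))
          (sub_nonpos.mpr h)
      · exact mul_nonneg
          (sub_nonneg.mpr (exp_le_exp.mpr (mul_le_mul_of_nonneg_left h hpos.le)))
          (sub_nonneg.mpr h)
    have hfreq := (hdE.hasDerivWithinAt (s := Set.Ici x)).liminf_right_slope_le
      (lt_of_le_of_lt hnonpos hr)
    refine (hfreq.and_eventually self_mem_nhdsWithin).mono fun z hz => ?_
    refine lt_of_le_of_lt ?_ hz.1
    have hxz : 0 < z - x := sub_pos.mpr hz.2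
    rw [slope_def_field, slope_def_field, hEx]
    gcongr
    exact hfE z
  have h0 : f 0 = ∑ i, exp ((2 - t) * l i) * (mpow (expConj l C 1) t i i).re := by
    simp [hf]
  have h1 : f 1 = ∑ i, exp (2 * l i) * (mpow C t i i).re := by
    simp [hf, expConj, expDiag_zero]
  rwa [h0, h1] at hmain

end DiagonalScaling

section GeomMean

variable {n : ℕ} {A B : Matrix (Fin n) (Fin n) ℂ}

lemma mpow_isHermitian (hA : A.PosDef) (r : ℝ) : (mpow A r)ᴴ = mpow A r :=
  (mpow_posDef hA r).isHermitian

lemma mpow_conj_posDef (hA : A.PosDef) (hB : B.PosDef) (r : ℝ) :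
    (mpow A r * B * mpow A r).PosDef := by
  have h := hB.mul_mul_conjTranspose_same (B := mpow A r) (by
    refine Function.LeftInverse.injective (g := fun v => v ᵥ* mpow A (-r)) fun v => ?_
    simp only [vecMul_vecMul, mpow_mul_mpow_neg hA, vecMul_one])
  rwa [mpow_isHermitian hA] at h

lemma mpow_eq_conj_expDiag (hA : A.PosDef) (r : ℝ) :
    mpow A r = (hA.isHermitian.eigenvectorUnitary : Matrix (Fin n) (Fin n) ℂ) *
      expDiag (fun i => Real.log (hA.isHermitian.eigenvalues i)) r *
      star (hA.isHermitian.eigenvectorUnitary : Matrix (Fin n) (Fin n) ℂ) := by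
  rw [mpow, dif_pos hA.isHermitian, expDiag]
  congr 3
  funext i
  rw [Real.rpow_def_of_pos (hA.eigenvalues_pos i), mul_comm]

lemma trace_expDiag_mul_re (l : Fin n → ℝ) (s : ℝ) (X : Matrix (Fin n) (Fin n) ℂ) :
    (expDiag l s * X).trace.re = ∑ i, Real.exp (s * l i) * (X i i).re := by
  simp only [trace, diag_apply, Complex.re_sum, expDiag, diagonal_mul, Complex.re_ofReal_mul]

lemma mpow_half_mul_mpow_half (hA : A.PosDef) : mpow A (1 / 2) * mpow A (1 / 2) = A := by
  rw [mpow_mul_mpow hA, add_halves, mpow_one' hA]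

lemma trace_mul_geomMean (hA : A.PosDef) (t : ℝ) :
    (A * geomMean A B t).trace =
      (mpow A 2 * mpow (mpow A (-(1 / 2)) * B * mpow A (-(1 / 2))) t).trace := by
  set X := mpow (mpow A (-(1 / 2)) * B * mpow A (-(1 / 2))) t with hX
  rw [geomMean, ← hX, ← mul_assoc, trace_mul_comm, ← mul_assoc, ← mul_assoc]
  congr 2
  nth_rewrite 2 [← mpow_one' hA]
  rw [mpow_mul_mpow hA, mpow_mul_mpow hA]
  norm_num

lemma mpow_half_conj_cancel (hA : A.PosDef) (X : Matrix (Fin n) (Fin n) ℂ) :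
    mpow A (1 / 2) * (mpow A (-(1 / 2)) * X * mpow A (-(1 / 2))) * mpow A (1 / 2) = X := by
  calc _ = (mpow A (1 / 2) * mpow A (-(1 / 2))) * X *
        (mpow A (-(1 / 2)) * mpow A (1 / 2)) := by simp only [mul_assoc]
    _ = X := by rw [mpow_mul_mpow_neg hA, mpow_neg_mul_mpow hA, one_mul, mul_one]

lemma geomMean_zero (hA : A.PosDef) (hB : B.PosDef) : geomMean A B 0 = A := by
  rw [geomMean, mpow_zero' (mpow_conj_posDef hA hB _), mul_one, mpow_half_mul_mpow_half hA]

lemma geomMean_one (hA : A.PosDef) (hB : B.PosDef) : geomMean A B 1 = B := by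
  rw [geomMean, mpow_one' (mpow_conj_posDef hA hB _), mpow_half_conj_cancel hA]

lemma trace_mul_geomMean_le (hA : A.PosDef) (hB : B.PosDef) {t : ℝ} (ht : t ∈ Set.Icc (0 : ℝ) 1) :
    (A * geomMean A B t).trace.re ≤ (mpow A (2 - t) * mpow B t).trace.re := by
  rcases ht.1.eq_or_lt with rfl | h0
  · rw [geomMean_zero hA hB, mpow_zero' hB, mul_one, sub_zero]
    nth_rewrite 1 2 [← mpow_one' hA]
    rw [mpow_mul_mpow hA, one_add_one_eq_two]
  rcases ht.2.eq_or_lt with rfl | h1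
  · rw [geomMean_one hA hB, mpow_one' hB, show (2 : ℝ) - 1 = 1 by norm_num, mpow_one' hA]
  set C := mpow A (-(1 / 2)) * B * mpow A (-(1 / 2)) with hC
  have hCpos : C.PosDef := mpow_conj_posDef hA hB _
  set U := hA.isHermitian.eigenvectorUnitary with hU
  set l : Fin n → ℝ := fun i => Real.log (hA.isHermitian.eigenvalues i) with hl
  set V : Matrix (Fin n) (Fin n) ℂ := (U : Matrix (Fin n) (Fin n) ℂ) with hV
  have hVV : star V * V = 1 := Unitary.coe_star_mul_self U
  have hpow : ∀ r, mpow A r = V * expDiag l r * star V := mpow_eq_conj_expDiag hA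
  have hconj : ∀ X : Matrix (Fin n) (Fin n) ℂ, X.IsHermitian → ∀ r,
      mpow (star V * X * V) r = star V * mpow X r * V := by
    intro X hX r
    simpa using mpow_conj hX (star U) r
  have htr : ∀ (X : Matrix (Fin n) (Fin n) ℂ) (s : ℝ),
      (mpow A s * X).trace = (expDiag l s * (star V * X * V)).trace := by
    intro X s
    rw [hpow, mul_assoc, mul_assoc, trace_mul_comm]
    simp only [mul_assoc]
  have hB' : star V * B * V = expConj l (star V * C * V) 1 := by
    have e1 : expDiag l (1 / 2) * star V = star V * mpow A (1 / 2) := by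
      rw [hpow, mul_assoc, ← mul_assoc, hVV, one_mul]
    have e2 : V * expDiag l (1 / 2) = mpow A (1 / 2) * V := by
      rw [hpow, mul_assoc, hVV, mul_one]
    rw [expConj]
    calc star V * B * V = star V * (mpow A (1 / 2) * C * mpow A (1 / 2)) * V := by
          rw [hC, mpow_half_conj_cancel hA]
      _ = (star V * mpow A (1 / 2)) * C * (mpow A (1 / 2) * V) := by simp only [mul_assoc]
      _ = _ := by rw [← e1, ← e2]; simp only [mul_assoc]
  have hC' : (star V * C * V).PosDef := by
    have := hCpos.conjTranspose_mul_mul_same (B := V) (by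
      refine Function.LeftInverse.injective (g := fun v => star V *ᵥ v) fun v => ?_
      simp only [mulVec_mulVec, hVV, one_mulVec])
    exact this
  rw [trace_mul_geomMean hA, ← hC, htr, htr, ← hconj _ hCpos.isHermitian,
    ← hconj _ hB.isHermitian, hB', trace_expDiag_mul_re, trace_expDiag_mul_re]
  exact sum_exp_mul_mpow_expConj_le l hC' ⟨h0, h1⟩

lemma geomMean_symm (hA : A.PosDef) (hB : B.PosDef) (t : ℝ) :
    geomMean A B t = geomMean B A (1 - t) := by
  set a := mpow A (1 / 2) with ha
  set a' := mpow A (-(1 / 2)) with ha'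
  set b := mpow B (1 / 2) with hb
  set b' := mpow B (-(1 / 2)) with hb'
  have haa' : a * a' = 1 := mpow_mul_mpow_neg hA _
  have ha'a : a' * a = 1 := mpow_neg_mul_mpow hA _
  have hbb' : b * b' = 1 := mpow_mul_mpow_neg hB _
  have hb'b : b' * b = 1 := mpow_neg_mul_mpow hB _
  have hbb : b * b = B := mpow_half_mul_mpow_half hB
  have haa : a * a = A := mpow_half_mul_mpow_half hA
  set C := a' * B * a' with hC
  set D := b' * A * b' with hD
  have hCp : C.PosDef := mpow_conj_posDef hA hB _
  have hDp : D.PosDef := mpow_conj_posDef hB hA _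
  set p := mpow C (1 / 2) with hp
  set p' := mpow C (-(1 / 2)) with hp'
  have hpp' : p * p' = 1 := mpow_mul_mpow_neg hCp _
  have hp'p : p' * p = 1 := mpow_neg_mul_mpow hCp _
  have hpp : p * p = C := mpow_half_mul_mpow_half hCp
  have ha's : star a' = a' := mpow_isHermitian hA _
  have hbs : star b = b := mpow_isHermitian hB _
  have hps : star p' = p' := mpow_isHermitian hCp _
  set W := p' * a' * b with hW
  have hWs : star W = b * a' * p' := by
    rw [hW, star_mul, star_mul, ha's, hbs, hps, mul_assoc]
  have hWW : W * star W = 1 := by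
    rw [hWs, hW]
    calc p' * a' * b * (b * a' * p') = p' * (a' * (b * b) * a') * p' := by simp only [mul_assoc]
      _ = (p' * p) * (p * p') := by rw [hbb, ← hC, ← hpp]; simp only [mul_assoc]
      _ = 1 := by rw [hp'p, hpp', one_mul]
  have hWW' : star W * W = 1 := mul_eq_one_comm.mp hWW
  let U : unitary (Matrix (Fin n) (Fin n) ℂ) := ⟨star W, by
    rw [Unitary.mem_iff, star_star]; exact ⟨hWW, hWW'⟩⟩
  have hconj : ∀ r, mpow (star W * C * W) r = star W * mpow C r * W := by
    intro r
    simpa [U] using mpow_conj hCp.isHermitian U r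
  have hinv : mpow D (-1) = star W * C * W := by
    have h1 : mpow D (-1) * D = 1 := by
      have := mpow_neg_mul_mpow hDp 1
      rwa [mpow_one' hDp] at this
    have h2 : D * (star W * C * W) = 1 := by
      have e : star W * C * W = b * a' * a' * b := by
        rw [hWs, hW, ← hpp]
        calc _ = b * a' * (p' * p) * (p * p') * a' * b := by simp only [mul_assoc]
          _ = _ := by rw [hp'p, hpp', mul_one, mul_one]
      rw [e, hD, ← haa]
      calc _ = b' * a * (a * (b' * b) * a') * a' * b := by simp only [mul_assoc]
        _ = 1 := by rw [hb'b, mul_one, haa', mul_one, mul_assoc b', haa', mul_one, hb'b]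
    calc mpow D (-1) = mpow D (-1) * (D * (star W * C * W)) := by rw [h2, mul_one]
      _ = _ := by rw [← mul_assoc, h1, one_mul]
  have hDt : mpow D (1 - t) = star W * mpow C (t - 1) * W := by
    rw [← hconj, ← hinv, mpow_mpow hDp]
    congr 1; ring
  have hbW : b * star W = a * p := by
    rw [hWs]
    calc b * (b * a' * p') = a * (a' * (b * b) * a') * p' := by
          calc _ = (b * b) * a' * p' := by simp only [mul_assoc]
            _ = (a * a') * (b * b) * a' * p' := by rw [haa', one_mul]
            _ = _ := by simp only [mul_assoc]
      _ = a * p := by rw [hbb, ← hC, ← hpp, mul_assoc, mul_assoc, hpp', mul_one]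
  have hWb : W * b = p * a := by
    rw [hW]
    calc p' * a' * b * b = p' * (a' * (b * b) * a') * a := by
          calc _ = p' * a' * (b * b) * (a' * a) := by rw [ha'a, mul_one, mul_assoc (p' * a')]
            _ = _ := by simp only [mul_assoc]
      _ = p * a := by rw [hbb, ← hC, ← hpp, ← mul_assoc p', hp'p, one_mul]
  have hpt : p * mpow C (t - 1) * p = mpow C t := by
    rw [hp, mpow_mul_mpow hCp, mpow_mul_mpow hCp]
    congr 1; ring
  calc geomMean A B t = a * mpow C t * a := rfl
    _ = (a * p) * mpow C (t - 1) * (p * a) := by rw [← hpt]; simp only [mul_assoc]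
    _ = b * (star W * mpow C (t - 1) * W) * b := by
      rw [← hbW, ← hWb]; simp only [mul_assoc]
    _ = geomMean B A (1 - t) := by rw [← hDt]; rfl

end GeomMean

section TraceInequalities

variable {n : ℕ} {A B C : Matrix (Fin n) (Fin n) ℂ}

lemma trace_conjTranspose_mul_self_re_nonneg (X : Matrix (Fin n) (Fin n) ℂ) :
    0 ≤ (Xᴴ * X).trace.re :=
  (Complex.le_def.mp (posSemidef_conjTranspose_mul_self X).trace_nonneg).1

lemma geomMean_posDef (hA : A.PosDef) (hB : B.PosDef) (t : ℝ) : (geomMean A B t).PosDef :=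
  mpow_conj_posDef hA (mpow_posDef (mpow_conj_posDef hA hB _) t) _

lemma trace_mul_mul_mul_self_re_le {X : Matrix (Fin n) (Fin n) ℂ} (hA : A.IsHermitian)
    (hX : X.IsHermitian) : (A * X * (A * X)).trace.re ≤ (A * A * (X * X)).trace.re := by
  have h := trace_conjTranspose_mul_self_re_nonneg (A * X - X * A)
  rw [conjTranspose_sub, conjTranspose_mul, conjTranspose_mul, hA.eq, hX.eq, mul_sub, sub_mul,
    sub_mul, trace_sub, trace_sub, trace_sub] at h
  have e1 : (X * A * (A * X)).trace = (A * A * (X * X)).trace := by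
    rw [mul_assoc, trace_mul_comm]; simp only [mul_assoc]
  have e2 : (X * A * (X * A)).trace = (A * X * (A * X)).trace := by
    rw [mul_assoc, trace_mul_comm]; simp only [mul_assoc]
  have e3 : (A * X * (X * A)).trace = (A * A * (X * X)).trace := by
    rw [← mul_assoc, trace_mul_comm]; simp only [mul_assoc]
  rw [e1, e2, e3] at h
  simp only [Complex.sub_re] at h
  linarith

lemma trace_geomMean_mul_geomMean (hA : A.PosDef) (s t : ℝ) :
    (geomMean A B s * geomMean A B t).trace =
      (A * mpow (mpow A (-(1 / 2)) * B * mpow A (-(1 / 2))) s *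
        (A * mpow (mpow A (-(1 / 2)) * B * mpow A (-(1 / 2))) t)).trace := by
  set X := mpow (mpow A (-(1 / 2)) * B * mpow A (-(1 / 2))) s with hX
  set Y := mpow (mpow A (-(1 / 2)) * B * mpow A (-(1 / 2))) t with hY
  set a := mpow A (1 / 2) with ha
  have haa : a * a = A := mpow_half_mul_mpow_half hA
  calc (a * X * a * (a * Y * a)).trace = (a * (X * (a * a) * Y * a)).trace := by
        simp only [mul_assoc]
    _ = (X * (a * a) * Y * (a * a)).trace := by rw [trace_mul_comm]; simp only [mul_assoc]
    _ = _ := by rw [haa, trace_mul_comm]; simp only [mul_assoc]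

lemma trace_geomMean_mul_self_le_of_le_half (hA : A.PosDef) (hB : B.PosDef) {t : ℝ} (h0 : 0 ≤ t)
    (h1 : t ≤ 1 / 2) :
    (geomMean A B t * geomMean A B t).trace.re ≤
      (mpow A (2 - 2 * t) * mpow B (2 * t)).trace.re := by
  have hC := mpow_conj_posDef hA hB (-(1 / 2))
  rw [trace_geomMean_mul_geomMean hA]
  refine (trace_mul_mul_mul_self_re_le hA.isHermitian (mpow_posDef hC t).isHermitian).trans ?_
  rw [mpow_mul_mpow hC, ← two_mul]
  refine le_of_eq_of_le ?_ (trace_mul_geomMean_le hA hB (t := 2 * t) ⟨by linarith, by linarith⟩)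
  rw [trace_mul_geomMean hA, ← one_add_one_eq_two, ← mpow_mul_mpow hA, mpow_one' hA]

lemma trace_geomMean_mul_self_le (hA : A.PosDef) (hB : B.PosDef) {t : ℝ}
    (ht : t ∈ Set.Icc (0 : ℝ) 1) :
    (geomMean A B t * geomMean A B t).trace.re ≤
      (mpow A (2 - 2 * t) * mpow B (2 * t)).trace.re := by
  rcases le_total t (1 / 2) with h | h
  · exact trace_geomMean_mul_self_le_of_le_half hA hB ht.1 h
  · rw [geomMean_symm hA hB, trace_mul_comm (mpow A _)]
    have := trace_geomMean_mul_self_le_of_le_half hB hA (t := 1 - t) (by linarith [ht.2])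
      (by linarith)
    rwa [show 2 - 2 * (1 - t) = 2 * t by ring, show 2 * (1 - t) = 2 - 2 * t by ring] at this

lemma trace_mul_mpow_mul_mpow_le (hA : A.IsHermitian) (hC : C.PosDef) {t : ℝ}
    (ht : t ∈ Set.Icc (0 : ℝ) 1) :
    (A * mpow C t * (A * mpow C (1 - t))).trace.re ≤ (A * A * C).trace.re := by
  set l : Fin n → ℝ := fun i => Real.log (hC.isHermitian.eigenvalues i) with hl
  set V := (hC.isHermitian.eigenvectorUnitary : Matrix (Fin n) (Fin n) ℂ) with hV
  have hVV : V * star V = 1 := Unitary.coe_mul_star_self _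
  have hpow : ∀ r, mpow C r = V * expDiag l r * star V := mpow_eq_conj_expDiag hC
  set K := star V * A * V with hK
  have hKh : K.IsHermitian := isHermitian_conjTranspose_mul_mul _ hA
  have key : ∀ s u, (A * mpow C s * (A * mpow C u)).trace.re =
      ∑ i, ∑ j, Real.exp (s * l j) * Real.exp (u * l i) * Complex.normSq (K i j) := by
    intro s u
    have e : (A * mpow C s * (A * mpow C u)).trace =
        (K * expDiag l s * (K * expDiag l u)).trace := by
      rw [hpow, hpow]
      calc _ = ((A * V * expDiag l s * star V * A * V * expDiag l u) * star V).trace := by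
            simp only [mul_assoc]
        _ = _ := by rw [trace_mul_comm, hK]; simp only [mul_assoc]
    rw [e, trace, Complex.re_sum]
    refine Finset.sum_congr rfl fun i _ => ?_
    rw [diag_apply, mul_apply, Complex.re_sum]
    refine Finset.sum_congr rfl fun j _ => ?_
    rw [expDiag, expDiag, mul_diagonal, mul_diagonal, ← hKh.apply j i, RCLike.star_def,
      show ∀ z x y w : ℂ, z * x * (y * w) = x * w * (z * y) by intros; ring, Complex.mul_conj,
      ← Complex.ofReal_mul, ← Complex.ofReal_mul, Complex.ofReal_re]
  have hend : (A * A * C).trace.re = (A * mpow C 0 * (A * mpow C 1)).trace.re := by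
    rw [mpow_zero' hC, mpow_one' hC, mul_one, mul_assoc]
  have hswap : ∀ s u, ∑ i, ∑ j, Real.exp (s * l j) * Real.exp (u * l i) * Complex.normSq (K i j) =
      ∑ i, ∑ j, Real.exp (s * l i) * Real.exp (u * l j) * Complex.normSq (K i j) := by
    intro s u
    rw [Finset.sum_comm]
    refine Finset.sum_congr rfl fun i _ => Finset.sum_congr rfl fun j _ => ?_
    rw [← hKh.apply, RCLike.star_def, Complex.normSq_conj]
  have hdouble : ∀ s u, 2 * (A * mpow C s * (A * mpow C u)).trace.re =
      ∑ i, ∑ j, (Real.exp (s * l j) * Real.exp (u * l i) + Real.exp (s * l i) *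
        Real.exp (u * l j)) * Complex.normSq (K i j) := by
    intro s u
    rw [two_mul, key]
    nth_rewrite 2 [hswap]
    simp only [← Finset.sum_add_distrib, add_mul]
  refine le_of_mul_le_mul_left ?_ (zero_lt_two (α := ℝ))
  rw [hend, hdouble, hdouble]
  refine Finset.sum_le_sum fun i _ => Finset.sum_le_sum fun j _ =>
    mul_le_mul_of_nonneg_right ?_ (Complex.normSq_nonneg _)
  have hsplit : ∀ x, Real.exp (1 * x) = Real.exp (t * x) * Real.exp ((1 - t) * x) := by
    intro x; rw [← Real.exp_add]; congr 1; ring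
  have hprod : 0 ≤ (Real.exp (t * l i) - Real.exp (t * l j)) *
      (Real.exp ((1 - t) * l i) - Real.exp ((1 - t) * l j)) := by
    have h1 : 0 ≤ 1 - t := sub_nonneg.mpr ht.2
    rcases le_total (l i) (l j) with h | h
    · exact mul_nonneg_of_nonpos_of_nonpos
        (sub_nonpos.mpr (Real.exp_le_exp.mpr (mul_le_mul_of_nonneg_left h ht.1)))
        (sub_nonpos.mpr (Real.exp_le_exp.mpr (mul_le_mul_of_nonneg_left h h1)))
    · exact mul_nonneg
        (sub_nonneg.mpr (Real.exp_le_exp.mpr (mul_le_mul_of_nonneg_left h ht.1)))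
        (sub_nonneg.mpr (Real.exp_le_exp.mpr (mul_le_mul_of_nonneg_left h h1)))
  simp only [zero_mul, Real.exp_zero, one_mul] at hsplit ⊢
  rw [hsplit (l i), hsplit (l j)]
  linarith

lemma trace_geomMean_mul_geomMean_le (hA : A.PosDef) (hB : B.PosDef) {t : ℝ}
    (ht : t ∈ Set.Icc (0 : ℝ) 1) :
    (geomMean A B t * geomMean A B (1 - t)).trace.re ≤ (A * B).trace.re := by
  have hC := mpow_conj_posDef hA hB (-(1 / 2))
  rw [trace_geomMean_mul_geomMean hA]
  refine (trace_mul_mpow_mul_mpow_le hA.isHermitian hC ht).trans_eq ?_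
  have h := trace_mul_geomMean (B := B) hA 1
  rw [geomMean_one hA hB, mpow_one' hC, show mpow A 2 = A * A by
    rw [← one_add_one_eq_two, ← mpow_mul_mpow hA, mpow_one' hA]] at h
  rw [h]

lemma trace_conjTranspose_mul_self_add_smul {S X : Matrix (Fin n) (Fin n) ℂ}
    (hS : S.IsHermitian) (r : ℝ) :
    ((S + r • X)ᴴ * (S + r • X)).trace.re =
      (S * S).trace.re + 2 * r * (S * X).trace.re + r ^ 2 * (Xᴴ * X).trace.re := by
  have h : (Xᴴ * S).trace.re = (S * X).trace.re := by
    rw [← Complex.conj_re (S * X).trace, ← RCLike.star_def, ← trace_conjTranspose,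
      conjTranspose_mul, hS.eq]
  rw [conjTranspose_add, conjTranspose_smul, hS.eq, star_trivial, add_mul, mul_add, mul_add]
  simp only [smul_mul_assoc, mul_smul_comm, trace_add, trace_smul, Complex.add_re,
    Complex.smul_re, smul_eq_mul, h]
  ring

lemma trace_add_mul_geomMean_le (hA : A.PosDef) (hB : B.PosDef) {t : ℝ}
    (ht : t ∈ Set.Icc (0 : ℝ) 1) :
    ((A + B) * geomMean A B t).trace.re ≤
      ((A + B) * (mpow A (1 - t) * mpow B t)).trace.re := by
  have h1 := trace_mul_geomMean_le hA hB ht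
  have h2 := trace_mul_geomMean_le hB hA (t := 1 - t) ⟨sub_nonneg.mpr ht.2, by linarith [ht.1]⟩
  rw [← geomMean_symm hA hB] at h2
  have e1 : A * (mpow A (1 - t) * mpow B t) = mpow A (2 - t) * mpow B t := by
    nth_rewrite 1 [← mpow_one' hA]
    rw [← mul_assoc, mpow_mul_mpow hA]
    congr 2; ring
  have e2 : (B * (mpow A (1 - t) * mpow B t)).trace =
      (mpow B (2 - (1 - t)) * mpow A (1 - t)).trace := by
    rw [trace_mul_comm, trace_mul_comm (mpow B _), mul_assoc]
    nth_rewrite 2 [← mpow_one' hB]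
    rw [mpow_mul_mpow hB]
    congr 3; ring
  rw [add_mul, add_mul, trace_add, trace_add, Complex.add_re, Complex.add_re, e1, e2]
  exact add_le_add h1 h2

lemma trace_conjTranspose_mul_self_mpow_add (hA : A.PosDef) (hB : B.PosDef) (t : ℝ) :
    ((mpow A t * mpow B (1 - t) + mpow A (1 - t) * mpow B t)ᴴ *
      (mpow A t * mpow B (1 - t) + mpow A (1 - t) * mpow B t)).trace.re =
    (mpow A (2 - 2 * (1 - t)) * mpow B (2 * (1 - t))).trace.re + 2 * (A * B).trace.re +
      (mpow A (2 - 2 * t) * mpow B (2 * t)).trace.re := by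
  have key : ∀ p q u v, (mpow B q * mpow A p * (mpow A u * mpow B v)).trace =
      (mpow A (p + u) * mpow B (v + q)).trace := by
    intro p q u v
    rw [mul_assoc, trace_mul_comm, ← mul_assoc, mpow_mul_mpow hA, mul_assoc, mpow_mul_mpow hB]
  simp only [conjTranspose_add, conjTranspose_mul, mpow_isHermitian hA, mpow_isHermitian hB,
    add_mul, mul_add, trace_add, key, Complex.add_re]
  simp only [sub_add_cancel, add_sub_cancel, mpow_one' hA, mpow_one' hB]
  rw [show t + t = 2 - 2 * (1 - t) by ring, show (1 - t) + (1 - t) = 2 - 2 * t by ring,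
    show 2 - 2 * (1 - t) = 2 * t by ring, show 2 * (1 - t) = 2 - 2 * t by ring]
  ring

end TraceInequalities

/-- `‖A + B + r(A♯ₜB + A♯₁₋ₜB)‖₂ ≤ ‖A + B + r(AᵗB^{1-t} + A^{1-t}Bᵗ)‖₂`. -/
theorem stmt_9 {n : ℕ} (A B : Matrix (Fin n) (Fin n) ℂ)
    (hA : A.PosDef) (hB : B.PosDef) (t : ℝ) (ht : t ∈ Set.Icc (0:ℝ) 1)
    (r : ℝ) (hr : 0 ≤ r) :
    hsNorm (A + B + r • (geomMean A B t + geomMean A B (1 - t))) ≤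
      hsNorm (A + B + r • (mpow A t * mpow B (1 - t) + mpow A (1 - t) * mpow B t)) := by
  have ht' : 1 - t ∈ Set.Icc (0 : ℝ) 1 := ⟨sub_nonneg.mpr ht.2, by linarith [ht.1]⟩
  have hG := (geomMean_posDef hA hB t).isHermitian
  have hH := (geomMean_posDef hA hB (1 - t)).isHermitian
  have hS := (hA.add hB).isHermitian
  have l1 := trace_add_mul_geomMean_le hA hB ht
  have l2 := trace_add_mul_geomMean_le hA hB ht'
  have q1 := trace_geomMean_mul_self_le hA hB ht
  have q2 := trace_geomMean_mul_self_le hA hB ht'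
  have q3 := trace_geomMean_mul_geomMean_le hA hB ht
  refine Real.sqrt_le_sqrt ?_
  rw [trace_conjTranspose_mul_self_add_smul hS, trace_conjTranspose_mul_self_add_smul hS,
    trace_conjTranspose_mul_self_mpow_add hA hB, conjTranspose_add, hG.eq, hH.eq]
  simp only [mul_add, add_mul, trace_add, Complex.add_re] at l1 l2 ⊢
  rw [trace_mul_comm (geomMean A B (1 - t)) (geomMean A B t)]
  rw [sub_sub_cancel] at l2
  have hl := mul_le_mul_of_nonneg_left (add_le_add l1 l2) (mul_nonneg zero_le_two hr)
  have hq := mul_le_mul_of_nonneg_left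
    (add_le_add (add_le_add q1 q2) (mul_le_mul_of_nonneg_left q3 zero_le_two)) (sq_nonneg r)
  linarith
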